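/- Let λ_i ∈ (0,1] and γ_i ∈ [0,1] for i = 1,…,n, and suppose: P ∈ ℝ^{n×n} has entries p_{ij} = (1−λ_i)(1−γ_i) if j = k_i and p_{ij} = 0 otherwise, for some indices k_i ∈ {1,…,n}; Q ∈ ℝ^{n×l} has entries q_{ik} = (1−λ_i)γ_i if k = l_i and q_{ik} = 0 otherwise, for some indices l_i ∈ {1,…,l}; and A ∈ ℝ^{l×n} is row-stochastic. Then the matrix I_n − P − Q·A is strictly row diagonally dominant (for every row i, the absolute value of the diagonal entry strictly exceeds the sum of the absolute values of the off-diagonal entries), and hence invertible. -/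

import Mathlib

/-- A matrix is row-stochastic if all entries are nonnegative and each row sums to 1. -/
def RowStochastic {m n : ℕ} (A : Matrix (Fin m) (Fin n) ℝ) : Prop :=
  (∀ i j, 0 ≤ A i j) ∧ ∀ i, (∑ j, A i j) = 1

/-- If `B` is entrywise nonnegative with all row sums less than `1`, then `1 - B` is strictly row
diagonally dominant. -/
theorem sum_abs_one_sub_lt_abs_diag {ι : Type*} [Fintype ι] [DecidableEq ι] (B : Matrix ι ι ℝ)
    (hB : ∀ i j, 0 ≤ B i j) (hsum : ∀ i, ∑ j, B i j < 1) (i : ι) :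
    ∑ j ∈ Finset.univ.erase i, |(1 - B) i j| < |(1 - B) i i| := by
  have hoff : ∑ j ∈ Finset.univ.erase i, |(1 - B) i j| = ∑ j ∈ Finset.univ.erase i, B i j := by
    refine Finset.sum_congr rfl fun j hj => ?_
    rw [Matrix.sub_apply, Matrix.one_apply_ne (Finset.ne_of_mem_erase hj).symm, zero_sub, abs_neg,
      abs_of_nonneg (hB i j)]
  have hsplit := Finset.add_sum_erase Finset.univ (B i) (Finset.mem_univ i)
  calc ∑ j ∈ Finset.univ.erase i, |(1 - B) i j| < 1 - B i i := by linarith [hsum i]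
    _ = (1 - B) i i := by rw [Matrix.sub_apply, Matrix.one_apply_eq]
    _ ≤ |(1 - B) i i| := le_abs_self _

/-- Lemma 4.3: with $P$, $Q$ the one-non-zero-entry-per-row descriptive matrices and $A$
row-stochastic, the matrix $I_n - P - QA$ is strictly row diagonally dominant, hence
invertible. -/
theorem stmt15 {n l : ℕ}
    (lam γ : Fin n → ℝ)
    (hlam : ∀ i, 0 < lam i ∧ lam i ≤ 1) (hγ : ∀ i, 0 ≤ γ i ∧ γ i ≤ 1)
    (k : Fin n → Fin n) (r : Fin n → Fin l)
    (P : Matrix (Fin n) (Fin n) ℝ) (Q : Matrix (Fin n) (Fin l) ℝ)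
    (hPdef : ∀ i j, P i j = if j = k i then (1 - lam i) * (1 - γ i) else 0)
    (hQdef : ∀ i j, Q i j = if j = r i then (1 - lam i) * γ i else 0)
    (A : Matrix (Fin l) (Fin n) ℝ) (hA : RowStochastic A) :
    (∀ i, ∑ j ∈ Finset.univ.erase i,
        |((1 : Matrix (Fin n) (Fin n) ℝ) - P - Q * A) i j|
      < |((1 : Matrix (Fin n) (Fin n) ℝ) - P - Q * A) i i|) ∧
    IsUnit ((1 : Matrix (Fin n) (Fin n) ℝ) - P - Q * A) := by
  have hQA : ∀ i j, (Q * A) i j = (1 - lam i) * γ i * A (r i) j := fun i j => by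
    simp [Matrix.mul_apply, hQdef]
  have hnonneg : ∀ i j, 0 ≤ (P + Q * A) i j := fun i j => by
    have hl : 0 ≤ 1 - lam i := sub_nonneg.2 (hlam i).2
    have hg : 0 ≤ 1 - γ i := sub_nonneg.2 (hγ i).2
    rw [Matrix.add_apply, hPdef, hQA]
    refine add_nonneg ?_ (mul_nonneg (mul_nonneg hl (hγ i).1) (hA.1 _ _))
    split_ifs
    · exact mul_nonneg hl hg
    · exact le_rfl
  have hsum : ∀ i, ∑ j, (P + Q * A) i j < 1 := fun i => by
    have hrow : ∑ j, (P + Q * A) i j = 1 - lam i := by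
      simp only [Matrix.add_apply, hPdef, hQA, Finset.sum_add_distrib, Finset.sum_ite_eq',
        Finset.mem_univ, if_true, ← Finset.mul_sum, hA.2]
      ring
    linarith [(hlam i).1]
  rw [sub_sub]
  have hdom := sum_abs_one_sub_lt_abs_diag (P + Q * A) hnonneg hsum
  refine ⟨hdom, (Matrix.isUnit_iff_isUnit_det _).2 (isUnit_iff_ne_zero.2 ?_)⟩
  exact det_ne_zero_of_sum_row_lt_diag hdom
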